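/- arXiv:1712.05702 — 4 statements merged into one kernel-verified Lean document; each statement's English description precedes it below -/
import Mathlib

section
/- (Fannes–Audenaert inequality, as stated in the paper.) Let d ≥ 2 and let Φ and Ψ be density matrices on ℂ^d. If ‖Φ − Ψ‖₁ ≤ μ for some μ with 0 ≤ μ < 1/e, then |S(Φ) − S(Ψ)| ≤ μ·log₂(d − 1) + h(μ). -/
open scoped BigOperators ComplexOrder

/-- The von Neumann entropy (base-2) of a matrix, via its eigenvalues when Hermitian. -/
noncomputable def vnEntropy {n : Type*} [Fintype n] [DecidableEq n]
    (M : Matrix n n ℂ) : ℝ :=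
  if h : M.IsHermitian then -∑ i, h.eigenvalues i * Real.logb 2 (h.eigenvalues i) else 0

/-- The trace norm of a Hermitian matrix: sum of absolute values of eigenvalues. -/
noncomputable def traceNorm {n : Type*} [Fintype n] [DecidableEq n]
    (M : Matrix n n ℂ) : ℝ :=
  if h : M.IsHermitian then ∑ i, |h.eigenvalues i| else 0

/-- The binary entropy function (base 2), with the convention `0 * logb 2 0 = 0`. -/
noncomputable def binEntropy (x : ℝ) : ℝ :=
  -(x * Real.logb 2 x) - (1 - x) * Real.logb 2 (1 - x)

/-- The squared moduli of the entries in each row of a unitary matrix sum to one. -/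
theorem Matrix.sum_normSq_row_of_mem_unitaryGroup {n : Type*} [Fintype n] [DecidableEq n]
    {W : Matrix n n ℂ} (hW : W ∈ Matrix.unitaryGroup n ℂ) (i : n) :
    ∑ k, Complex.normSq (W i k) = 1 := by
  have h := congrFun (congrFun (Matrix.mem_unitaryGroup_iff.mp hW) i) i
  simp only [Matrix.mul_apply, Matrix.star_apply, RCLike.star_def, Complex.mul_conj,
    Matrix.one_apply_eq] at h
  exact_mod_cast h

/-- The squared moduli of the entries in each column of a unitary matrix sum to one. -/
theorem Matrix.sum_normSq_col_of_mem_unitaryGroup {n : Type*} [Fintype n] [DecidableEq n]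
    {W : Matrix n n ℂ} (hW : W ∈ Matrix.unitaryGroup n ℂ) (k : n) :
    ∑ i, Complex.normSq (W i k) = 1 := by
  have h := congrFun (congrFun (Matrix.mem_unitaryGroup_iff'.mp hW) k) k
  simp only [Matrix.mul_apply, Matrix.star_apply, RCLike.star_def, mul_comm, Complex.mul_conj,
    Matrix.one_apply_eq] at h
  exact_mod_cast h

/-- The spectral theorem as an equation between matrices. -/
theorem Matrix.IsHermitian.eq_mul_diagonal_mul_star {n : Type*} [Fintype n] [DecidableEq n]
    {A : Matrix n n ℂ} (hA : A.IsHermitian) :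
    A = (hA.eigenvectorUnitary : Matrix n n ℂ) *
      Matrix.diagonal (fun k => (hA.eigenvalues k : ℂ)) *
        star (hA.eigenvectorUnitary : Matrix n n ℂ) := by
  conv_lhs => rw [hA.spectral_theorem]
  rfl

/-- The diagonal of a Hermitian matrix in any orthonormal basis is a doubly stochastic image of
its eigenvalues. -/
theorem Matrix.IsHermitian.exists_unitary_diag {n : Type*} [Fintype n] [DecidableEq n]
    {A : Matrix n n ℂ} (hA : A.IsHermitian) {V : Matrix n n ℂ}
    (hV : V ∈ Matrix.unitaryGroup n ℂ) :
    ∃ W ∈ Matrix.unitaryGroup n ℂ, ∀ i,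
      ((star V * A * V) i i).re = ∑ k, Complex.normSq (W i k) * hA.eigenvalues k := by
  refine ⟨star V * hA.eigenvectorUnitary, mul_mem (Unitary.star_mem hV) hA.eigenvectorUnitary.2,
    fun i => ?_⟩
  set U : Matrix n n ℂ := (hA.eigenvectorUnitary : Matrix n n ℂ) with hU
  have hspec : A = U * Matrix.diagonal (fun k => (hA.eigenvalues k : ℂ)) * star U :=
    hA.eq_mul_diagonal_mul_star
  have h : star V * A * V =
      (star V * U) * Matrix.diagonal (fun k => (hA.eigenvalues k : ℂ)) * star (star V * U) := by
    conv_lhs => rw [hspec]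
    simp [mul_assoc]
  rw [h, Matrix.mul_apply, Complex.re_sum]
  refine Finset.sum_congr rfl fun k _ => ?_
  rw [Matrix.mul_diagonal, Matrix.star_apply, RCLike.star_def, mul_right_comm, Complex.mul_conj,
    ← Complex.ofReal_mul, Complex.ofReal_re]

/-- In its own eigenbasis the diagonal of a Hermitian matrix consists of its eigenvalues. -/
theorem Matrix.IsHermitian.diag_eigenvectorUnitary {n : Type*} [Fintype n] [DecidableEq n]
    {A : Matrix n n ℂ} (hA : A.IsHermitian) (i : n) :
    ((star (hA.eigenvectorUnitary : Matrix n n ℂ) * A * hA.eigenvectorUnitary) i i).re =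
      hA.eigenvalues i := by
  set U : Matrix n n ℂ := (hA.eigenvectorUnitary : Matrix n n ℂ) with hU
  have hspec : A = U * Matrix.diagonal (fun k => (hA.eigenvalues k : ℂ)) * star U :=
    hA.eq_mul_diagonal_mul_star
  have hUU : star U * U = 1 := Matrix.mem_unitaryGroup_iff'.mp hA.eigenvectorUnitary.2
  have h : star U * A * U = Matrix.diagonal (fun k => (hA.eigenvalues k : ℂ)) := by
    conv_lhs => rw [hspec]
    calc _ = (star U * U) * Matrix.diagonal (fun k => (hA.eigenvalues k : ℂ)) * (star U * U) := by
          simp only [mul_assoc]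
      _ = _ := by rw [hUU, one_mul, mul_one]
  rw [h, Matrix.diagonal_apply_eq, Complex.ofReal_re]

/-- Applying a doubly stochastic matrix does not decrease the Shannon entropy. -/
theorem sum_negMulLog_le_of_doublyStochastic {n : Type*} [Fintype n] {D : n → n → ℝ} {x p : n → ℝ}
    (hD : ∀ i k, 0 ≤ D i k) (hrow : ∀ i, ∑ k, D i k = 1) (hcol : ∀ k, ∑ i, D i k = 1)
    (hx : ∀ k, 0 ≤ x k) (hp : ∀ i, p i = ∑ k, D i k * x k) :
    ∑ k, Real.negMulLog (x k) ≤ ∑ i, Real.negMulLog (p i) := by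
  have h : ∀ i, ∑ k, D i k * Real.negMulLog (x k) ≤ Real.negMulLog (p i) := fun i => by
    rw [hp i]
    simpa only [smul_eq_mul] using Real.concaveOn_negMulLog.le_map_sum (t := Finset.univ)
      (w := D i) (p := x) (fun k _ => hD i k) (hrow i) (fun k _ => hx k)
  calc ∑ k, Real.negMulLog (x k) = ∑ k, ∑ i, D i k * Real.negMulLog (x k) := by
        simp_rw [← Finset.sum_mul, hcol, one_mul]
    _ = ∑ i, ∑ k, D i k * Real.negMulLog (x k) := Finset.sum_comm
    _ ≤ _ := Finset.sum_le_sum fun i _ => h i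

/-- A pointwise Gibbs-type inequality. -/
theorem mul_log_div_le_sub {r p q s : ℝ} (hr : 0 ≤ r) (hrp : r ≤ p) (hq : 0 ≤ q) (hs : 0 ≤ s)
    (h0 : r ≠ 0 → q ≠ 0 ∧ s ≠ 0) :
    r * (Real.log q + Real.log s - Real.log p) ≤ q * s - r := by
  rcases eq_or_ne r 0 with rfl | hr0
  · simpa using mul_nonneg hq hs
  obtain ⟨hq0, hs0⟩ := h0 hr0
  have hp : 0 < p := (hr.lt_of_ne' hr0).trans_le hrp
  have hqs : 0 < q * s := by positivity
  rw [← Real.log_mul hq0 hs0, ← Real.log_div hqs.ne' hp.ne']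
  calc r * Real.log (q * s / p) ≤ r * (q * s / p - 1) :=
        mul_le_mul_of_nonneg_left (Real.log_le_sub_one_of_pos (by positivity)) hr
    _ = r / p * (q * s) - r := by field_simp
    _ ≤ _ := by
        have := mul_le_mul_of_nonneg_right ((div_le_one hp).mpr hrp) hqs.le
        linarith

/-- Two probability vectors have a coupling that puts mass `min (p i) (q i)` on the diagonal. -/
theorem exists_coupling {n : Type*} [Fintype n] {p q : n → ℝ}
    (hp : ∀ i, 0 ≤ p i) (hq : ∀ i, 0 ≤ q i) (hpq : ∑ i, p i = ∑ i, q i) :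
    ∃ r : n → n → ℝ, (∀ i j, 0 ≤ r i j) ∧ (∀ i, ∑ j, r i j = p i) ∧
      (∀ j, ∑ i, r i j = q j) ∧ ∀ i, r i i = min (p i) (q i) := by
  classical
  set a : n → ℝ := fun i => p i - min (p i) (q i) with ha
  set b : n → ℝ := fun i => q i - min (p i) (q i) with hb
  have ha0 : ∀ i, 0 ≤ a i := fun i => sub_nonneg.mpr (min_le_left _ _)
  have hb0 : ∀ i, 0 ≤ b i := fun i => sub_nonneg.mpr (min_le_right _ _)
  have hab : ∑ i, a i = ∑ i, b i := by simp [ha, hb, Finset.sum_sub_distrib, hpq]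
  have hdiag : ∀ i, a i * b i = 0 := fun i => by
    rcases le_total (p i) (q i) with h | h <;> simp [ha, hb, h]
  set T := ∑ i, b i with hT
  have hT0 : 0 ≤ T := Finset.sum_nonneg fun i _ => hb0 i
  have haT : ∀ i, a i * T / T = a i := fun i => by
    rcases eq_or_ne T 0 with h | h
    · have := (Finset.sum_eq_zero_iff_of_nonneg fun i _ => ha0 i).mp (hab.trans h) i
        (Finset.mem_univ i)
      simp [this]
    · field_simp
  have hbT : ∀ i, T * b i / T = b i := fun i => by
    rcases eq_or_ne T 0 with h | h
    · have := (Finset.sum_eq_zero_iff_of_nonneg fun i _ => hb0 i).mp h i (Finset.mem_univ i)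
      simp [this]
    · field_simp
  refine ⟨fun i j => (if i = j then min (p i) (q i) else 0) + a i * b j / T, fun i j => ?_,
    fun i => ?_, fun j => ?_, fun i => ?_⟩
  · refine add_nonneg ?_ (div_nonneg (mul_nonneg (ha0 i) (hb0 j)) hT0)
    split_ifs
    exacts [le_min (hp i) (hq i), le_rfl]
  · rw [Finset.sum_add_distrib, Finset.sum_ite_eq, if_pos (Finset.mem_univ i), ← Finset.sum_div,
      ← Finset.mul_sum, ← hT, haT]
    simp [ha]
  · rw [Finset.sum_add_distrib, Finset.sum_ite_eq', if_pos (Finset.mem_univ j), ← Finset.sum_div,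
      ← Finset.sum_mul, hab, hbT]
    simp [hb]
  · simp [hdiag i]

/-- The classical Fannes–Audenaert inequality for probability vectors, in natural units. -/
theorem sum_negMulLog_sub_le {d : ℕ} (hd : 2 ≤ d) {p q : Fin d → ℝ}
    (hp : ∀ i, 0 ≤ p i) (hq : ∀ i, 0 ≤ q i) (hp1 : ∑ i, p i = 1) (hq1 : ∑ i, q i = 1)
    {μ : ℝ} (hμ0 : 0 ≤ μ) (hμ : μ ≤ 1 / 2) (hdist : ∑ i, |p i - q i| ≤ μ) :
    ∑ i, Real.negMulLog (p i) - ∑ i, Real.negMulLog (q i) ≤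
      μ * Real.log ((d : ℝ) - 1) + Real.binEntropy μ := by
  obtain ⟨r, hr0, hrp, hrq, hrd⟩ := exists_coupling hp hq (hp1.trans hq1.symm)
  have hd1 : (1 : ℝ) ≤ (d : ℝ) - 1 := by
    have : (2 : ℝ) ≤ d := by exact_mod_cast hd
    linarith
  set t := μ / ((d : ℝ) - 1) with ht
  have ht0 : 0 ≤ t := by positivity
  have htμ : t ≤ μ := div_le_self hμ0 hd1
  set s : Fin d → Fin d → ℝ := fun i j => if i = j then 1 - μ else t with hs
  have hs0 : ∀ i j, 0 ≤ s i j := fun i j => by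
    simp only [hs]; split_ifs <;> linarith
  have hs1 : ∀ j, ∑ i, s i j = 1 := fun j => by
    have h : ∀ i, s i j = t + if i = j then 1 - μ - t else 0 := fun i => by
      simp only [hs]; split_ifs <;> ring
    simp_rw [h, Finset.sum_add_distrib, Finset.sum_ite_eq', if_pos (Finset.mem_univ j)]
    simp only [Finset.sum_const, Finset.card_univ, Fintype.card_fin, nsmul_eq_mul, ht]
    field_simp
    ring
  have hrle : ∀ i j, r i j ≤ p i := fun i j =>
    hrp i ▸ Finset.single_le_sum (fun j _ => hr0 i j) (Finset.mem_univ j)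
  have hrle' : ∀ i j, r i j ≤ q j := fun i j =>
    hrq j ▸ Finset.single_le_sum (f := fun i => r i j) (fun i _ => hr0 i j) (Finset.mem_univ i)
  have hsum : ∑ i, ∑ j, r i j = 1 := by simp_rw [hrp, hp1]
  set m := ∑ i, r i i with hm
  have hmμ : 1 - m ≤ μ := by
    refine le_trans ?_ hdist
    rw [hm, ← hp1, ← Finset.sum_sub_distrib]
    refine Finset.sum_le_sum fun i _ => ?_
    rw [hrd]
    rcases le_total (p i) (q i) with h | h
    · rw [min_eq_left h, sub_self]; positivity
    · rw [min_eq_right h]; exact le_abs_self _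
  have hzero : μ = 0 → ∀ i j, i ≠ j → r i j = 0 := fun h i j hij => by
    have hpqi : r i i = p i := by
      have : |p i - q i| ≤ 0 := (Finset.single_le_sum (f := fun i => |p i - q i|)
        (fun i _ => abs_nonneg _) (Finset.mem_univ i)).trans (hdist.trans h.le)
      rw [hrd, sub_eq_zero.mp (abs_nonpos_iff.mp this), min_self]
    have := Finset.add_le_sum (f := r i) (fun k _ => hr0 i k) (Finset.mem_univ i)
      (Finset.mem_univ j) hij
    rw [hrp] at this
    linarith [hr0 i j]
  have hpt : ∀ i j, r i j * (Real.log (q j) + Real.log (s i j) - Real.log (p i)) ≤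
      q j * s i j - r i j := fun i j =>
    mul_log_div_le_sub (hr0 i j) (hrle i j) (hq j) (hs0 i j) fun h => by
      refine ⟨((hr0 i j).lt_of_ne' h |>.trans_le (hrle' i j)).ne', ?_⟩
      simp only [hs]
      split_ifs with hij
      · linarith
      · have hμ' : μ ≠ 0 := fun h' => h (hzero h' i j hij)
        positivity
  have hq' : ∑ i, ∑ j, r i j * Real.log (q j) = - ∑ j, Real.negMulLog (q j) := by
    rw [Finset.sum_comm, ← Finset.sum_neg_distrib]
    simp_rw [← Finset.sum_mul, hrq, Real.negMulLog, neg_mul, neg_neg]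
  have hp' : ∑ i, ∑ j, r i j * Real.log (p i) = - ∑ i, Real.negMulLog (p i) := by
    rw [← Finset.sum_neg_distrib]
    simp_rw [← Finset.sum_mul, hrp, Real.negMulLog, neg_mul, neg_neg]
  have hs' : ∑ i, ∑ j, r i j * Real.log (s i j) =
      m * Real.log (1 - μ) + (1 - m) * Real.log t := by
    have h : ∀ i j, r i j * Real.log (s i j) = r i j * Real.log t +
        if i = j then r i j * (Real.log (1 - μ) - Real.log t) else 0 := fun i j => by
      simp only [hs]; split_ifs <;> ring
    simp_rw [h, Finset.sum_add_distrib, Finset.sum_ite_eq, if_pos (Finset.mem_univ _),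
      ← Finset.sum_mul, hsum, ← hm]
    ring
  have hqs : ∑ i, ∑ j, q j * s i j = 1 := by
    rw [Finset.sum_comm]
    simp_rw [← Finset.mul_sum, hs1, mul_one, hq1]
  have key := Finset.sum_le_sum fun i (_ : i ∈ Finset.univ) =>
    Finset.sum_le_sum fun j (_ : j ∈ Finset.univ) => hpt i j
  simp only [mul_sub, mul_add, Finset.sum_sub_distrib, Finset.sum_add_distrib, hq', hp', hs', hqs,
    hsum] at key
  rw [Real.binEntropy_eq_negMulLog_add_negMulLog_one_sub, Real.negMulLog, Real.negMulLog]
  rcases hμ0.eq_or_lt with rfl | hμpos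
  · have hm1 : t = 0 := by simp [ht]
    simp [hm1] at key ⊢
    linarith
  · have hlt : Real.log t = Real.log μ - Real.log ((d : ℝ) - 1) :=
      Real.log_div hμpos.ne' (by linarith)
    have hmono : Real.log t ≤ Real.log (1 - μ) :=
      Real.log_le_log (by positivity) (by linarith)
    have := mul_nonneg (sub_nonneg.mpr hmμ) (sub_nonneg.mpr hmono)
    have h2 : μ * Real.log t = μ * Real.log μ - μ * Real.log ((d : ℝ) - 1) := by rw [hlt]; ring
    linarith

theorem vnEntropy_eq_sum_negMulLog {n : Type*} [Fintype n] [DecidableEq n] {A : Matrix n n ℂ}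
    (hA : A.IsHermitian) :
    vnEntropy A = (∑ i, Real.negMulLog (hA.eigenvalues i)) / Real.log 2 := by
  rw [vnEntropy, dif_pos hA, ← Finset.sum_neg_distrib, Finset.sum_div]
  refine Finset.sum_congr rfl fun i _ => ?_
  rw [Real.logb, Real.negMulLog]
  ring

theorem binEntropy_eq_div_log_two (x : ℝ) : binEntropy x = Real.binEntropy x / Real.log 2 := by
  rw [binEntropy, Real.binEntropy_eq_negMulLog_add_negMulLog_one_sub, Real.negMulLog,
    Real.negMulLog, Real.logb, Real.logb]
  ring

theorem Matrix.IsHermitian.sum_eigenvalues_eq_one {n : Type*} [Fintype n] [DecidableEq n]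
    {A : Matrix n n ℂ} (hA : A.IsHermitian) (htr : A.trace = 1) : ∑ i, hA.eigenvalues i = 1 := by
  have h := hA.trace_eq_sum_eigenvalues
  rw [htr] at h
  exact Complex.ofReal_injective (by simpa using h.symm)

/-- Restricting a Hermitian matrix to its diagonal in an orthonormal basis does not increase its trace norm. -/
theorem Matrix.IsHermitian.sum_abs_diag_le_traceNorm {n : Type*} [Fintype n] [DecidableEq n]
    {A : Matrix n n ℂ} (hA : A.IsHermitian) {V : Matrix n n ℂ}
    (hV : V ∈ Matrix.unitaryGroup n ℂ) :
    ∑ i, |((star V * A * V) i i).re| ≤ traceNorm A := by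
  obtain ⟨W, hW, h⟩ := hA.exists_unitary_diag hV
  rw [traceNorm, dif_pos hA]
  calc ∑ i, |((star V * A * V) i i).re|
      ≤ ∑ i, ∑ k, Complex.normSq (W i k) * |hA.eigenvalues k| := by
        refine Finset.sum_le_sum fun i _ => ?_
        rw [h i]
        refine (Finset.abs_sum_le_sum_abs _ _).trans_eq (Finset.sum_congr rfl fun k _ => ?_)
        rw [abs_mul, abs_of_nonneg (Complex.normSq_nonneg _)]
    _ = _ := by
        rw [Finset.sum_comm]
        simp_rw [← Finset.sum_mul, Matrix.sum_normSq_col_of_mem_unitaryGroup hW, one_mul]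

/-- The one-sided Fannes–Audenaert inequality. -/
theorem vnEntropy_sub_le {d : ℕ} (hd : 2 ≤ d) {Φ Ψ : Matrix (Fin d) (Fin d) ℂ}
    (hΦ : Φ.PosSemidef) (hΦtr : Φ.trace = 1) (hΨ : Ψ.PosSemidef) (hΨtr : Ψ.trace = 1)
    {μ : ℝ} (hμ0 : 0 ≤ μ) (hμ : μ ≤ 1 / 2) (hdist : traceNorm (Φ - Ψ) ≤ μ) :
    vnEntropy Φ - vnEntropy Ψ ≤ μ * Real.logb 2 ((d : ℝ) - 1) + binEntropy μ := by
  have hΦH := hΦ.isHermitian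
  have hΨH := hΨ.isHermitian
  set V : Matrix (Fin d) (Fin d) ℂ := (hΨH.eigenvectorUnitary : Matrix (Fin d) (Fin d) ℂ) with hVdef
  have hV : V ∈ Matrix.unitaryGroup (Fin d) ℂ := hΨH.eigenvectorUnitary.2
  obtain ⟨W, hW, hp⟩ := hΦH.exists_unitary_diag hV
  set p : Fin d → ℝ := fun i => ((star V * Φ * V) i i).re with hpdef
  have hp0 : ∀ i, 0 ≤ p i := fun i => by
    simp only [hpdef, hp i]
    exact Finset.sum_nonneg fun k _ => mul_nonneg (Complex.normSq_nonneg _) (hΦ.eigenvalues_nonneg k)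
  have hp1 : ∑ i, p i = 1 := by
    simp only [hpdef, hp]
    rw [Finset.sum_comm]
    simp_rw [← Finset.sum_mul, Matrix.sum_normSq_col_of_mem_unitaryGroup hW, one_mul]
    exact hΦH.sum_eigenvalues_eq_one hΦtr
  have hschur : ∑ k, Real.negMulLog (hΦH.eigenvalues k) ≤ ∑ i, Real.negMulLog (p i) :=
    sum_negMulLog_le_of_doublyStochastic (fun i k => Complex.normSq_nonneg (W i k))
      (Matrix.sum_normSq_row_of_mem_unitaryGroup hW)
      (Matrix.sum_normSq_col_of_mem_unitaryGroup hW) hΦ.eigenvalues_nonneg hp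
  have hpq : ∑ i, |p i - hΨH.eigenvalues i| ≤ μ := by
    refine le_trans (le_of_eq (Finset.sum_congr rfl fun i _ => ?_))
      (((hΦH.sub hΨH).sum_abs_diag_le_traceNorm hV).trans hdist)
    rw [← hΨH.diag_eigenvectorUnitary i, ← hVdef, mul_sub, sub_mul, Matrix.sub_apply,
      Complex.sub_re]
  have hclass := sum_negMulLog_sub_le hd hp0 hΨ.eigenvalues_nonneg hp1
    (hΨH.sum_eigenvalues_eq_one hΨtr) hμ0 hμ hpq
  rw [vnEntropy_eq_sum_negMulLog hΦH, vnEntropy_eq_sum_negMulLog hΨH, binEntropy_eq_div_log_two,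
    Real.logb, ← mul_div_assoc, ← sub_div, ← add_div]
  have : 0 < Real.log 2 := Real.log_pos one_lt_two
  gcongr
  linarith

theorem traceNorm_sub_le_swap {n : Type*} [Fintype n] [DecidableEq n] {A B : Matrix n n ℂ}
    (h : (A - B).IsHermitian) : traceNorm (B - A) ≤ traceNorm (A - B) := by
  have h' : (B - A).IsHermitian := neg_sub A B ▸ h.neg
  refine le_trans (le_of_eq ?_) (h.sum_abs_diag_le_traceNorm h'.eigenvectorUnitary.2)
  rw [traceNorm, dif_pos h']
  refine Finset.sum_congr rfl fun i _ => ?_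
  rw [← h'.diag_eigenvectorUnitary i]
  generalize (h'.eigenvectorUnitary : Matrix n n ℂ) = V
  rw [← neg_sub A B, mul_neg, neg_mul, Matrix.neg_apply, Complex.neg_re, abs_neg]

/-- **Fannes–Audenaert inequality.** -/
theorem fannes_audenaert (d : ℕ) (hd : 2 ≤ d)
    (Φ Ψ : Matrix (Fin d) (Fin d) ℂ)
    (hΦ : Φ.PosSemidef) (hΦtr : Φ.trace = 1)
    (hΨ : Ψ.PosSemidef) (hΨtr : Ψ.trace = 1)
    (μ : ℝ) (hμ0 : 0 ≤ μ) (hμ1 : μ < 1 / Real.exp 1)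
    (hdist : traceNorm (Φ - Ψ) ≤ μ) :
    |vnEntropy Φ - vnEntropy Ψ| ≤ μ * Real.logb 2 ((d : ℝ) - 1) + binEntropy μ := by
  have hμ : μ ≤ 1 / 2 := hμ1.le.trans
    (one_div_le_one_div_of_le two_pos (by linarith [Real.exp_one_gt_d9]))
  have hdist' : traceNorm (Ψ - Φ) ≤ μ :=
    (traceNorm_sub_le_swap (hΦ.isHermitian.sub hΨ.isHermitian)).trans hdist
  rw [abs_sub_le_iff]
  exact ⟨vnEntropy_sub_le hd hΦ hΦtr hΨ hΨtr hμ0 hμ hdist,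
    vnEntropy_sub_le hd hΨ hΨtr hΦ hΦtr hμ0 hμ hdist'⟩
end

section
/- (Alicki–Fannes inequality, the lemma cited and used in the paper.) Let ρ and σ be density matrices on a bipartite system, i.e. matrices indexed by Fin d_A × Fin d_B, with ‖ρ − σ‖₁ ≤ ε for some ε with 0 ≤ ε < 1. Then S(A|B)_ρ − S(A|B)_σ ≤ 4ε·log₂ d_A + 2h(ε). -/
open scoped BigOperators ComplexOrder

/-- Partial trace over the first (A) factor of a bipartite matrix. -/
noncomputable def ptraceA {dA dB : ℕ}
    (M : Matrix (Fin dA × Fin dB) (Fin dA × Fin dB) ℂ) : Matrix (Fin dB) (Fin dB) ℂ :=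
  Matrix.of fun b b' => ∑ a, M (a, b) (a, b')

/-- Conditional entropy S(A|B)_ρ = S(ρ) - S(tr_A ρ). -/
noncomputable def condEntropyAB {dA dB : ℕ}
    (ρ : Matrix (Fin dA × Fin dB) (Fin dA × Fin dB) ℂ) : ℝ :=
  vnEntropy ρ - vnEntropy (ptraceA ρ)

theorem negMulLog_le_tangent {a m : ℝ} (ha : 0 ≤ a) (hm : 0 < m) :
    Real.negMulLog a ≤ -(a * Real.log m) + m - a := by
  rcases ha.eq_or_lt with rfl | ha
  · simp [hm.le]
  · have h := Real.log_le_sub_one_of_pos (div_pos hm ha)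
    rw [Real.log_div hm.ne' ha.ne'] at h
    have h2 := mul_le_mul_of_nonneg_left h ha.le
    have h3 : a * (m / a - 1) = m - a := by field_simp
    rw [Real.negMulLog]
    linarith

theorem sum_mul_negMulLog_le {ι : Type*} [Fintype ι] (w x : ι → ℝ) (hw : ∀ i, 0 ≤ w i)
    (hx : ∀ i, 0 ≤ x i) (hw1 : ∑ i, w i ≤ 1) :
    ∑ i, w i * Real.negMulLog (x i) ≤ Real.negMulLog (∑ i, w i * x i) := by
  set m := ∑ i, w i * x i with hm
  have hnn : ∀ i ∈ Finset.univ, 0 ≤ w i * x i := fun i _ => mul_nonneg (hw i) (hx i)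
  have hm0 : 0 ≤ m := Finset.sum_nonneg hnn
  rcases hm0.eq_or_lt with h0 | hpos
  · rw [← h0, Real.negMulLog_zero]
    refine Finset.sum_nonpos fun i hi => ?_
    have := (Finset.sum_eq_zero_iff_of_nonneg hnn).1 (hm.symm.trans h0.symm) i hi
    rw [Real.negMulLog, neg_mul, mul_neg, ← mul_assoc, this]
    simp
  · calc ∑ i, w i * Real.negMulLog (x i)
        ≤ ∑ i, w i * (-(x i * Real.log m) + m - x i) := Finset.sum_le_sum fun i _ =>
          mul_le_mul_of_nonneg_left (negMulLog_le_tangent (hx i) hpos) (hw i)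
      _ = -(m * Real.log m) + (∑ i, w i) * m - m := by
          conv_rhs => rw [hm]
          simp only [Finset.sum_mul, ← Finset.sum_neg_distrib, ← Finset.sum_add_distrib,
            ← Finset.sum_sub_distrib]
          refine Finset.sum_congr rfl fun i _ => ?_
          ring
      _ ≤ Real.negMulLog m := by
          rw [Real.negMulLog]
          nlinarith

theorem sum_negMulLog_le {ι : Type*} [Fintype ι] (x : ι → ℝ) (hx : ∀ i, 0 ≤ x i) :
    ∑ i, Real.negMulLog (x i) ≤
      Real.negMulLog (∑ i, x i) + (∑ i, x i) * Real.log (Fintype.card ι) := by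
  set m := ∑ i, x i with hm
  have hnn : ∀ i ∈ Finset.univ, 0 ≤ x i := fun i _ => hx i
  have hm0 : 0 ≤ m := Finset.sum_nonneg hnn
  rcases hm0.eq_or_lt with h0 | hpos
  · have : ∀ i, x i = 0 := fun i =>
      (Finset.sum_eq_zero_iff_of_nonneg hnn).1 (hm.symm.trans h0.symm) i (Finset.mem_univ i)
    simp [← h0, this]
  · have hne : Nonempty ι := by
      by_contra h
      rw [not_nonempty_iff] at h
      simp [hm] at hpos
    have hc : (0 : ℝ) < Fintype.card ι := by exact_mod_cast Fintype.card_pos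
    calc ∑ i, Real.negMulLog (x i)
        ≤ ∑ i, (-(x i * Real.log (m / Fintype.card ι)) + m / Fintype.card ι - x i) :=
          Finset.sum_le_sum fun i _ => negMulLog_le_tangent (hx i) (div_pos hpos hc)
      _ = -(m * Real.log (m / Fintype.card ι)) + m - m := by
          rw [Finset.sum_sub_distrib, Finset.sum_add_distrib, Finset.sum_neg_distrib,
            ← Finset.sum_mul, ← hm]
          simp only [Finset.sum_const, Finset.card_univ, nsmul_eq_mul]
          rw [mul_div_cancel₀ m hc.ne']
      _ = _ := by
          rw [Real.log_div hpos.ne' hc.ne', Real.negMulLog]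
          ring

theorem negMulLog_add_le {a b t : ℝ} (ha : 0 ≤ a) (hb : 0 ≤ b) (ht : 0 < t) (ht1 : t < 1) :
    Real.negMulLog a + Real.negMulLog b ≤
      Real.negMulLog (a + b) - a * Real.log t - b * Real.log (1 - t) := by
  rcases (add_nonneg ha hb).eq_or_lt with h0 | hpos
  · obtain rfl : a = 0 := by linarith
    obtain rfl : b = 0 := by linarith
    simp
  · have h1 := negMulLog_le_tangent ha (mul_pos ht hpos)
    have h2 := negMulLog_le_tangent hb (mul_pos (sub_pos.2 ht1) hpos)
    rw [Real.log_mul ht.ne' hpos.ne'] at h1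
    rw [Real.log_mul (sub_pos.2 ht1).ne' hpos.ne'] at h2
    rw [show Real.negMulLog (a + b) = -(a + b) * Real.log (a + b) from rfl]
    linarith

theorem entropy_mixing_bound {y : ℝ} (hy : 0 < y) (hy1 : y < 1 / 2) :
    (1 + y) * Real.log (1 + y) + (1 - 2 * y) * Real.log (1 - 2 * y) + y * Real.log y ≤
      y * Real.log 2 := by
  have h1 : (1 + y) * Real.log (1 + y) ≤ 2 * y * (3 / 2 * Real.log (3 / 2)) := by
    have := Real.convexOn_mul_log.2 (show (1 : ℝ) ∈ Set.Ici 0 by simp)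
      (show (3 / 2 : ℝ) ∈ Set.Ici 0 by norm_num [Set.mem_Ici])
      (show 0 ≤ 1 - 2 * y by linarith) (show 0 ≤ 2 * y by linarith) (by ring)
    have he : (1 - 2 * y) * 1 + 2 * y * (3 / 2) = 1 + y := by ring
    simpa only [smul_eq_mul, he, Real.log_one, mul_zero, zero_add] using this
  have h2 : (1 - 2 * y) * Real.log (1 - 2 * y) ≤ 0 :=
    mul_nonpos_of_nonneg_of_nonpos (by linarith) (Real.log_nonpos (by linarith) (by linarith))
  have h3 : y * Real.log y ≤ y * -Real.log 2 := by
    refine mul_le_mul_of_nonneg_left ?_ hy.le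
    rw [← Real.log_inv]
    exact Real.log_le_log hy (by linarith)
  have h4 : 3 * Real.log (3 / 2) ≤ 2 * Real.log 2 := by
    have := Real.log_le_log (x := (3 / 2) ^ 3) (y := 2 ^ 2) (by norm_num) (by norm_num)
    simpa [Real.log_pow] using this
  nlinarith

/-- The entropy in natural units of a Hermitian matrix. -/
noncomputable def natEntropy {n : Type*} [Fintype n] [DecidableEq n] {M : Matrix n n ℂ}
    (hM : M.IsHermitian) : ℝ :=
  ∑ i, Real.negMulLog (hM.eigenvalues i)

theorem conjTranspose_mul_self_diag {n κ : Type*} [Fintype n] (V : Matrix n κ ℂ)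
    (k : κ) :
    (V.conjTranspose * V) k k = ((∑ i, Complex.normSq (V i k) : ℝ) : ℂ) := by
  simp [Matrix.mul_apply, Complex.normSq_eq_conj_mul_self]

theorem mul_conjTranspose_self_diag {n κ : Type*} [Fintype κ] (V : Matrix n κ ℂ)
    (i : n) :
    (V * V.conjTranspose) i i = ((∑ k, Complex.normSq (V i k) : ℝ) : ℂ) := by
  simp [Matrix.mul_apply, Complex.mul_conj]

/-- The diagonal of an idempotent Hermitian matrix is bounded by one. -/
theorem re_diag_le_one_of_idempotent {n : Type*} [Fintype n] {Q : Matrix n n ℂ}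
    (hQ : Q.IsHermitian) (hQQ : Q * Q = Q)
    (k : n) : (Q k k).re ≤ 1 := by
  have h : (Q k k).re = ∑ l, Complex.normSq (Q l k) := by
    have := conjTranspose_mul_self_diag Q k
    rw [hQ.eq, hQQ] at this
    rw [this, Complex.ofReal_re]
  have h2 : (Q k k).re ^ 2 ≤ (Q k k).re :=
    calc (Q k k).re ^ 2 ≤ Complex.normSq (Q k k) := by
          rw [Complex.normSq_apply]
          nlinarith [sq_nonneg (Q k k).im]
      _ ≤ ∑ l, Complex.normSq (Q l k) :=
          Finset.single_le_sum (f := fun l => Complex.normSq (Q l k))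
            (fun l _ => Complex.normSq_nonneg _) (Finset.mem_univ k)
      _ = (Q k k).re := h.symm
  nlinarith

section Spectral

variable {n : Type*} [Fintype n] [DecidableEq n] {M : Matrix n n ℂ}

theorem exists_diagonalization (hM : M.IsHermitian) :
    ∃ U : Matrix n n ℂ, U * U.conjTranspose = 1 ∧ U.conjTranspose * U = 1 ∧
      U.conjTranspose * M * U = Matrix.diagonal fun i => (hM.eigenvalues i : ℂ) := by
  refine ⟨hM.eigenvectorUnitary, ?_, ?_, ?_⟩
  · exact Unitary.coe_mul_star_self _
  · exact Unitary.coe_star_mul_self _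
  · have h := hM.conjStarAlgAut_star_eigenvectorUnitary
    rw [Unitary.conjStarAlgAut_star_apply] at h
    exact h

/-- The entropy of an ensemble average of unnormalized pure states is at most the Shannon entropy
of the weights. -/
theorem natEntropy_le_of_eq_mul_conjTranspose {κ : Type*} [Fintype κ]
    [DecidableEq κ] (hM : M.IsHermitian)
    (V : Matrix n κ ℂ) (hV : M = V * V.conjTranspose) :
    natEntropy hM ≤ ∑ k, Real.negMulLog (∑ i, Complex.normSq (V i k)) := by
  obtain ⟨U, hU, -, hd⟩ := exists_diagonalization hM
  set ev := hM.eigenvalues with hev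
  have hpos : ∀ i, 0 ≤ ev i := by
    have : M.PosSemidef := by
      rw [hV]
      exact Matrix.posSemidef_self_mul_conjTranspose V
    exact this.eigenvalues_nonneg
  obtain ⟨C, hC⟩ : ∃ C, C = U.conjTranspose * V := ⟨_, rfl⟩
  have hCC : C * C.conjTranspose = Matrix.diagonal fun i => (ev i : ℂ) := by
    rw [← hd, hV, hC, Matrix.conjTranspose_mul, Matrix.conjTranspose_conjTranspose]
    simp only [Matrix.mul_assoc]
  have hcol : C.conjTranspose * C = V.conjTranspose * V := by
    rw [hC, Matrix.conjTranspose_mul, Matrix.conjTranspose_conjTranspose, Matrix.mul_assoc,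
      ← Matrix.mul_assoc U, hU, Matrix.one_mul]
  have hrow : ∀ j, ∑ k, Complex.normSq (C j k) = ev j := fun j => by
    have := mul_conjTranspose_self_diag C j
    rw [hCC, Matrix.diagonal_apply_eq] at this
    exact_mod_cast this.symm
  set D : Matrix n n ℂ := Matrix.diagonal fun i => (((ev i)⁻¹ : ℝ) : ℂ) with hD
  have hDD : D * (C * C.conjTranspose) * D = D := by
    rw [hCC, hD, Matrix.diagonal_mul_diagonal, Matrix.diagonal_mul_diagonal]
    congr 1
    ext i
    push_cast
    by_cases h : (ev i : ℂ) = 0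
    · simp [h]
    · field_simp
  have hDH : D.conjTranspose = D := by
    rw [hD, Matrix.diagonal_conjTranspose]
    congr 1
    ext i
    simp
  obtain ⟨Q, hQdef⟩ : ∃ Q, Q = C.conjTranspose * D * C := ⟨_, rfl⟩
  have hQ : Q.IsHermitian := by
    rw [Matrix.IsHermitian, hQdef, Matrix.conjTranspose_mul, Matrix.conjTranspose_mul, hDH,
      Matrix.conjTranspose_conjTranspose, Matrix.mul_assoc]
  have hQQ : Q * Q = Q := by
    calc Q * Q = C.conjTranspose * (D * (C * C.conjTranspose) * D) * C := by
          rw [hQdef]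
          simp only [Matrix.mul_assoc]
      _ = Q := by rw [hDD, hQdef]
  have hQd : ∀ k, (Q k k).re = ∑ j, Complex.normSq (C j k) * (ev j)⁻¹ := fun k => by
    rw [hQdef, hD, Matrix.mul_apply, Complex.re_sum]
    refine Finset.sum_congr rfl fun j _ => ?_
    rw [Matrix.mul_diagonal, Matrix.conjTranspose_apply, mul_right_comm, RCLike.star_def,
      ← Complex.normSq_eq_conj_mul_self, ← Complex.ofReal_mul, Complex.ofReal_re]
  have hC0 : ∀ j k, Complex.normSq (C j k) * (ev j)⁻¹ * ev j = Complex.normSq (C j k) := by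
    intro j k
    by_cases h : ev j = 0
    · have h1 := hrow j
      rw [h, Finset.sum_eq_zero_iff_of_nonneg fun k _ => Complex.normSq_nonneg _] at h1
      simp [h1 k (Finset.mem_univ k)]
    · field_simp
  have hrow' : ∀ j, ∑ k, Complex.normSq (C j k) * (ev j)⁻¹ * Real.negMulLog (ev j) =
      Real.negMulLog (ev j) := fun j => by
    rw [← Finset.sum_mul, ← Finset.sum_mul, hrow]
    by_cases h : ev j = 0
    · simp [h]
    · field_simp
  calc natEntropy hM = ∑ j, ∑ k, Complex.normSq (C j k) * (ev j)⁻¹ * Real.negMulLog (ev j) :=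
        Finset.sum_congr rfl fun j _ => (hrow' j).symm
    _ = ∑ k, ∑ j, Complex.normSq (C j k) * (ev j)⁻¹ * Real.negMulLog (ev j) := Finset.sum_comm
    _ ≤ ∑ k, Real.negMulLog (∑ i, Complex.normSq (V i k)) := by
      refine Finset.sum_le_sum fun k _ => ?_
      have hVk : ∑ i, Complex.normSq (V i k) = ∑ j, Complex.normSq (C j k) * (ev j)⁻¹ * ev j := by
        simp only [hC0]
        have := conjTranspose_mul_self_diag V k
        rw [← hcol, conjTranspose_mul_self_diag] at this
        exact_mod_cast this.symm
      rw [hVk]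
      refine sum_mul_negMulLog_le _ _
        (fun j => mul_nonneg (Complex.normSq_nonneg _) (inv_nonneg.2 (hpos j))) hpos ?_
      rw [← hQd]
      exact re_diag_le_one_of_idempotent hQ hQQ k

theorem exists_eq_mul_conjTranspose (hM : M.PosSemidef) :
    ∃ V : Matrix n n ℂ, M = V * V.conjTranspose ∧
      ∀ k, ∑ i, Complex.normSq (V i k) = hM.1.eigenvalues k := by
  obtain ⟨U, hU, hU', hd⟩ := exists_diagonalization hM.1
  set S : Matrix n n ℂ := Matrix.diagonal fun i => (Real.sqrt (hM.1.eigenvalues i) : ℂ) with hS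
  have hSH : S.conjTranspose = S := by
    rw [hS, Matrix.diagonal_conjTranspose]
    congr 1
    ext i
    simp
  have hSS : S * S = Matrix.diagonal fun i => (hM.1.eigenvalues i : ℂ) := by
    rw [hS, Matrix.diagonal_mul_diagonal]
    congr 1
    ext i
    rw [← Complex.ofReal_mul, Real.mul_self_sqrt (hM.eigenvalues_nonneg i)]
  refine ⟨U * S, ?_, fun k => ?_⟩
  · rw [Matrix.conjTranspose_mul, hSH, Matrix.mul_assoc, ← Matrix.mul_assoc S, hSS, ← hd]
    calc M = (U * U.conjTranspose) * M * (U * U.conjTranspose) := by simp [hU]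
      _ = _ := by simp only [Matrix.mul_assoc]
  · have := conjTranspose_mul_self_diag (U * S) k
    rw [Matrix.conjTranspose_mul, Matrix.mul_assoc, ← Matrix.mul_assoc _ U, hU', Matrix.one_mul,
      hSH, hSS, Matrix.diagonal_apply_eq] at this
    exact_mod_cast this.symm

/-- Measuring in an orthonormal basis does not decrease the entropy. -/
theorem natEntropy_le_diag (hM : M.PosSemidef) (U : Matrix n n ℂ)
    (hU : U * U.conjTranspose = 1) :
    natEntropy hM.1 ≤ ∑ j, Real.negMulLog ((U.conjTranspose * M * U) j j).re := by
  obtain ⟨R, hRH, hRR⟩ : ∃ R : Matrix n n ℂ, R.conjTranspose = R ∧ R * R = M := by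
    open scoped MatrixOrder in
    exact ⟨CFC.sqrt M, (Matrix.nonneg_iff_posSemidef.1 (CFC.sqrt_nonneg M)).1,
      CFC.sqrt_mul_sqrt_self M hM.nonneg⟩
  have h := natEntropy_le_of_eq_mul_conjTranspose hM.1 (R * U) (by
    rw [Matrix.conjTranspose_mul, hRH, Matrix.mul_assoc, ← Matrix.mul_assoc U, hU, Matrix.one_mul,
      hRR])
  refine h.trans_eq (Finset.sum_congr rfl fun j _ => ?_)
  have h2 := conjTranspose_mul_self_diag (R * U) j
  rw [Matrix.conjTranspose_mul, hRH, Matrix.mul_assoc, ← Matrix.mul_assoc R, hRR,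
    ← Matrix.mul_assoc] at h2
  rw [h2, Complex.ofReal_re]

/-- Subadditivity of the entropy of unnormalized states. -/
theorem natEntropy_add_le {P Q : Matrix n n ℂ} (hP : P.PosSemidef) (hQ : Q.PosSemidef)
    (hPQ : (P + Q).IsHermitian) :
    natEntropy hPQ ≤ natEntropy hP.1 + natEntropy hQ.1 := by
  obtain ⟨V, hV, hVc⟩ := exists_eq_mul_conjTranspose hP
  obtain ⟨W, hW, hWc⟩ := exists_eq_mul_conjTranspose hQ
  have h := natEntropy_le_of_eq_mul_conjTranspose hPQ (Matrix.fromCols V W) (by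
    rw [Matrix.conjTranspose_fromCols_eq_fromRows_conjTranspose, Matrix.fromCols_mul_fromRows,
      ← hV, ← hW])
  simpa [Fintype.sum_sum_type, hVc, hWc, natEntropy] using h

/-- Concavity of the entropy, for unnormalized states. -/
theorem natEntropy_add_le_mixture {P Q : Matrix n n ℂ} (hP : P.PosSemidef) (hQ : Q.PosSemidef)
    (hPQ : (P + Q).IsHermitian) {t : ℝ} (ht : 0 < t) (ht1 : t < 1) :
    natEntropy hP.1 + natEntropy hQ.1 ≤
      natEntropy hPQ - P.trace.re * Real.log t - Q.trace.re * Real.log (1 - t) := by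
  obtain ⟨U, hU, -, hd⟩ := exists_diagonalization hPQ
  have htr : ∀ A : Matrix n n ℂ, ∑ j, ((U.conjTranspose * A * U) j j).re = A.trace.re := fun A => by
    rw [← Complex.re_sum]
    change (Matrix.trace (U.conjTranspose * A * U)).re = _
    rw [Matrix.trace_mul_comm, ← Matrix.mul_assoc, hU, Matrix.one_mul]
  have hnn : ∀ {A : Matrix n n ℂ}, A.PosSemidef → ∀ j, 0 ≤ ((U.conjTranspose * A * U) j j).re :=
    fun hA j => (Complex.nonneg_iff.1 (hA.conjTranspose_mul_mul_same U).diag_nonneg).1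
  have hsum : ∀ j, ((U.conjTranspose * P * U) j j).re + ((U.conjTranspose * Q * U) j j).re =
      hPQ.eigenvalues j := fun j => by
    rw [← Complex.add_re, ← Matrix.add_apply, ← Matrix.add_mul, ← Matrix.mul_add, hd,
      Matrix.diagonal_apply_eq, Complex.ofReal_re]
  calc natEntropy hP.1 + natEntropy hQ.1
      ≤ ∑ j, (Real.negMulLog ((U.conjTranspose * P * U) j j).re +
          Real.negMulLog ((U.conjTranspose * Q * U) j j).re) := by
        rw [Finset.sum_add_distrib]
        exact add_le_add (natEntropy_le_diag hP U hU) (natEntropy_le_diag hQ U hU)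
    _ ≤ ∑ j, (Real.negMulLog (hPQ.eigenvalues j) -
          ((U.conjTranspose * P * U) j j).re * Real.log t -
          ((U.conjTranspose * Q * U) j j).re * Real.log (1 - t)) :=
        Finset.sum_le_sum fun j _ => by
          rw [← hsum j]
          exact negMulLog_add_le (hnn hP j) (hnn hQ j) ht ht1
    _ = _ := by
        rw [Finset.sum_sub_distrib, Finset.sum_sub_distrib, ← Finset.sum_mul, ← Finset.sum_mul,
          htr, htr, natEntropy]

theorem exists_posSemidef_sub {H : Matrix n n ℂ} (hH : H.IsHermitian) :
    ∃ P N : Matrix n n ℂ, P.PosSemidef ∧ N.PosSemidef ∧ H = P - N ∧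
      P.trace.re + N.trace.re = ∑ i, |hH.eigenvalues i| := by
  obtain ⟨U, hU, hU', hd⟩ := exists_diagonalization hH
  have hpsd : ∀ f : n → ℝ, (∀ i, 0 ≤ f i) →
      (U * Matrix.diagonal (fun i => (f i : ℂ)) * U.conjTranspose).PosSemidef := fun f hf =>
    (Matrix.PosSemidef.diagonal fun i => Complex.zero_le_real.2 (hf i)).mul_mul_conjTranspose_same U
  have htr : ∀ f : n → ℝ,
      (U * Matrix.diagonal (fun i => (f i : ℂ)) * U.conjTranspose).trace.re = ∑ i, f i := by
    intro f
    rw [Matrix.trace_mul_comm, ← Matrix.mul_assoc, hU', Matrix.one_mul, Matrix.trace_diagonal,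
      Complex.re_sum]
    simp
  refine ⟨_, _, hpsd (fun i => (hH.eigenvalues i)⁺) (fun i => posPart_nonneg _),
    hpsd (fun i => (hH.eigenvalues i)⁻) (fun i => negPart_nonneg _), ?_, ?_⟩
  · rw [← Matrix.sub_mul, ← Matrix.mul_sub, Matrix.diagonal_sub]
    have : (fun i => (((hH.eigenvalues i)⁺ : ℝ) : ℂ) - (((hH.eigenvalues i)⁻ : ℝ) : ℂ)) =
        fun i => (hH.eigenvalues i : ℂ) := by
      ext i
      rw [← Complex.ofReal_sub, posPart_sub_negPart]
    rw [this, ← hd]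
    calc H = (U * U.conjTranspose) * H * (U * U.conjTranspose) := by simp [hU]
      _ = _ := by simp only [Matrix.mul_assoc]
  · rw [htr, htr, ← Finset.sum_add_distrib]
    exact Finset.sum_congr rfl fun i _ => posPart_add_negPart _

theorem trace_re_eq_sum_eigenvalues (hM : M.IsHermitian) :
    M.trace.re = ∑ i, hM.eigenvalues i := by
  rw [hM.trace_eq_sum_eigenvalues, Complex.re_sum]
  rfl

theorem natEntropy_congr {M' : Matrix n n ℂ} (h : M = M') (hM : M.IsHermitian)
    (hM' : M'.IsHermitian) : natEntropy hM = natEntropy hM' := by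
  subst h
  rfl

theorem vnEntropy_eq_natEntropy_div (hM : M.IsHermitian) :
    vnEntropy M = natEntropy hM / Real.log 2 := by
  rw [vnEntropy, dif_pos hM, natEntropy, Finset.sum_div, ← Finset.sum_neg_distrib]
  refine Finset.sum_congr rfl fun i _ => ?_
  rw [Real.negMulLog, Real.logb]
  ring

theorem natEntropy_sub_le {ρ σ P N : Matrix n n ℂ}
    (hρ : ρ.PosSemidef) (hσ : σ.PosSemidef) (hP : P.PosSemidef) (hN : N.PosSemidef)
    (h : ρ + N = σ + P) (hρtr : ρ.trace.re = 1) {y : ℝ} (hy : 0 < y) (hy1 : y < 1)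
    (hNtr : N.trace.re ≤ y) :
    natEntropy hρ.1 + natEntropy hN.1 ≤ natEntropy hσ.1 + natEntropy hP.1 +
      ((1 + y) * Real.log (1 + y) - y * Real.log y) := by
  have h1 := natEntropy_add_le_mixture hρ hN (hρ.add hN).1 (t := (1 + y)⁻¹) (by positivity)
    (inv_lt_one_of_one_lt₀ (by linarith))
  have h2 := natEntropy_add_le hσ hP (hσ.add hP).1
  rw [natEntropy_congr h (hρ.add hN).1 (hσ.add hP).1] at h1
  have ht : 1 - (1 + y)⁻¹ = y / (1 + y) := by
    field_simp
    ring
  rw [ht, Real.log_inv, Real.log_div hy.ne' (by positivity), hρtr] at h1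
  have h3 : 0 ≤ Real.log (1 + y) - Real.log y :=
    sub_nonneg.2 (Real.log_le_log hy (by linarith))
  have h4 := mul_le_mul_of_nonneg_right hNtr h3
  linarith

end Spectral

section Bipartite

variable {dA dB : ℕ} {M : Matrix (Fin dA × Fin dB) (Fin dA × Fin dB) ℂ}

theorem ptraceA_add (M N : Matrix (Fin dA × Fin dB) (Fin dA × Fin dB) ℂ) :
    ptraceA (M + N) = ptraceA M + ptraceA N := by
  ext b b'
  simp [ptraceA, Finset.sum_add_distrib]

theorem trace_ptraceA (M : Matrix (Fin dA × Fin dB) (Fin dA × Fin dB) ℂ) :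
    (ptraceA M).trace = M.trace := by
  simp only [ptraceA, Matrix.trace, Matrix.diag, Matrix.of_apply]
  rw [Fintype.sum_prod_type, Finset.sum_comm]

theorem ptraceA_mul_conjTranspose {κ : Type*} [Fintype κ] (V : Matrix (Fin dA × Fin dB) κ ℂ) :
    ptraceA (V * V.conjTranspose) =
      (Matrix.of fun b (k : Fin dA × κ) => V (k.1, b) k.2) *
        (Matrix.of fun b (k : Fin dA × κ) => V (k.1, b) k.2).conjTranspose := by
  ext b b'
  simp [ptraceA, Matrix.mul_apply, Fintype.sum_prod_type]

theorem posSemidef_ptraceA (hM : M.PosSemidef) : (ptraceA M).PosSemidef := by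
  obtain ⟨V, hV, -⟩ := exists_eq_mul_conjTranspose hM
  rw [hV, ptraceA_mul_conjTranspose]
  exact Matrix.posSemidef_self_mul_conjTranspose _

/-- The conditional entropy is at least `-log dA`. -/
theorem natEntropy_ptraceA_le (hM : M.PosSemidef) :
    natEntropy (posSemidef_ptraceA hM).1 ≤ natEntropy hM.1 + M.trace.re * Real.log dA := by
  obtain ⟨V, hV, hVc⟩ := exists_eq_mul_conjTranspose hM
  refine (natEntropy_le_of_eq_mul_conjTranspose (posSemidef_ptraceA hM).1
    (Matrix.of fun b (k : Fin dA × (Fin dA × Fin dB)) => V (k.1, b) k.2)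
    (by rw [← ptraceA_mul_conjTranspose, ← hV])).trans ?_
  rw [Fintype.sum_prod_type_right, trace_re_eq_sum_eigenvalues hM.1, natEntropy, Finset.sum_mul,
    ← Finset.sum_add_distrib]
  refine Finset.sum_le_sum fun i _ => ?_
  have h := sum_negMulLog_le (fun a : Fin dA => ∑ b : Fin dB, Complex.normSq (V (a, b) i))
    fun a => Finset.sum_nonneg fun b _ => Complex.normSq_nonneg _
  rw [← Fintype.sum_prod_type (f := fun x : Fin dA × Fin dB => Complex.normSq (V x i)), hVc,
    Fintype.card_fin] at h
  exact h

/-- The conditional entropy is at most `log dA`. -/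
theorem natEntropy_le_ptraceA (hM : M.PosSemidef) :
    natEntropy hM.1 ≤ natEntropy (posSemidef_ptraceA hM).1 + M.trace.re * Real.log dA := by
  obtain ⟨F, hF, -, hd⟩ := exists_diagonalization (posSemidef_ptraceA hM).1
  set U : Matrix (Fin dA × Fin dB) (Fin dA × Fin dB) ℂ :=
    Matrix.kroneckerMap (· * ·) (1 : Matrix (Fin dA) (Fin dA) ℂ) F with hUdef
  have hU : U * U.conjTranspose = 1 := by
    rw [hUdef, Matrix.conjTranspose_kronecker, ← Matrix.mul_kronecker_mul, hF,
      Matrix.conjTranspose_one, Matrix.one_mul, Matrix.one_kronecker_one]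
  have hsum : ∀ b, ∑ a, ((U.conjTranspose * M * U) (a, b) (a, b)).re =
      (posSemidef_ptraceA hM).1.eigenvalues b := by
    intro b
    have hb : (F.conjTranspose * ptraceA M * F) b b =
        ((posSemidef_ptraceA hM).1.eigenvalues b : ℂ) := by
      rw [hd, Matrix.diagonal_apply_eq]
    rw [← Complex.re_sum, ← Complex.ofReal_re ((posSemidef_ptraceA hM).1.eigenvalues b), ← hb]
    congr 1
    simp only [hUdef, Matrix.mul_apply, Matrix.conjTranspose_apply, Fintype.sum_prod_type,
      Matrix.kroneckerMap_apply, Matrix.one_apply, ptraceA, Matrix.of_apply]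
    simp only [ite_mul, mul_ite, one_mul, zero_mul, mul_zero, Finset.sum_mul,
      Finset.mul_sum, RCLike.star_def, Finset.sum_ite_irrel, Finset.sum_const_zero,
      Finset.sum_ite_eq', Finset.mem_univ, if_true]
    rw [Finset.sum_comm]
    refine Finset.sum_congr rfl fun x _ => ?_
    rw [Finset.sum_comm (s := (Finset.univ : Finset (Fin dB)))]
    refine Finset.sum_congr rfl fun a _ => ?_
    rw [Finset.sum_eq_single a (fun a' _ h => by simp [h]) (by simp)]
    simp
  refine (natEntropy_le_diag hM U hU).trans ?_
  rw [Fintype.sum_prod_type_right, ← trace_ptraceA,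
    trace_re_eq_sum_eigenvalues (posSemidef_ptraceA hM).1, natEntropy, Finset.sum_mul,
    ← Finset.sum_add_distrib]
  refine Finset.sum_le_sum fun b _ => ?_
  have h := sum_negMulLog_le (fun a : Fin dA => ((U.conjTranspose * M * U) (a, b) (a, b)).re)
    fun a => (Complex.nonneg_iff.1 (hM.conjTranspose_mul_mul_same U).diag_nonneg).1
  rw [hsum, Fintype.card_fin] at h
  exact h

theorem condEntropyAB_eq (hM : M.PosSemidef) :
    condEntropyAB M =
      (natEntropy hM.1 - natEntropy (posSemidef_ptraceA hM).1) / Real.log 2 := by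
  rw [condEntropyAB, vnEntropy_eq_natEntropy_div hM.1,
    vnEntropy_eq_natEntropy_div (posSemidef_ptraceA hM).1, sub_div]

end Bipartite

theorem binEntropy_nonneg {x : ℝ} (h0 : 0 ≤ x) (h1 : x ≤ 1) : 0 ≤ binEntropy x := by
  have h2 := mul_nonneg h0 (neg_nonneg.2 (Real.logb_nonpos one_lt_two h0 h1))
  have h3 := mul_nonneg (sub_nonneg.2 h1)
    (neg_nonneg.2 (Real.logb_nonpos one_lt_two (sub_nonneg.2 h1) (by linarith)))
  rw [binEntropy]
  linarith

/-- **Alicki–Fannes inequality.** -/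
theorem alicki_fannes (dA dB : ℕ)
    (ρ σ : Matrix (Fin dA × Fin dB) (Fin dA × Fin dB) ℂ)
    (hρ : ρ.PosSemidef) (hρtr : ρ.trace = 1)
    (hσ : σ.PosSemidef) (hσtr : σ.trace = 1)
    (ε : ℝ) (hε0 : 0 ≤ ε) (hε1 : ε < 1)
    (hdist : traceNorm (ρ - σ) ≤ ε) :
    condEntropyAB ρ - condEntropyAB σ
      ≤ 4 * ε * Real.logb 2 (dA : ℝ) + 2 * binEntropy ε := by
  have hh := binEntropy_nonneg hε0 hε1.le
  have hlog2 : 0 < Real.log 2 := Real.log_pos one_lt_two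
  have hH : (ρ - σ).IsHermitian := hρ.1.sub hσ.1
  obtain ⟨P, N, hP, hN, hPN, htr⟩ := exists_posSemidef_sub hH
  rw [traceNorm, dif_pos hH, ← htr] at hdist
  have htr0 : P.trace.re - N.trace.re = 0 := by
    rw [← Complex.sub_re, ← Matrix.trace_sub, ← hPN, Matrix.trace_sub, hρtr, hσtr, sub_self,
      Complex.zero_re]
  have hN0 : 0 ≤ N.trace.re := (Complex.nonneg_iff.1 hN.trace_nonneg).1
  have hsum : ρ + N = σ + P := by
    rw [← sub_eq_zero, add_sub_add_comm, hPN]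
    abel
  rcases hε0.eq_or_lt with rfl | hε
  · have hP0 : P = 0 := hP.trace_eq_zero_iff.1 (Complex.ext (by simp; linarith)
      (Complex.nonneg_iff.1 hP.trace_nonneg).2.symm)
    have hN0 : N = 0 := hN.trace_eq_zero_iff.1 (Complex.ext (by simp; linarith)
      (Complex.nonneg_iff.1 hN.trace_nonneg).2.symm)
    rw [hP0, hN0, add_zero, add_zero] at hsum
    rw [hsum, sub_self]
    simpa using hh
  rw [condEntropyAB_eq hρ, condEntropyAB_eq hσ, ← sub_div, div_le_iff₀ hlog2]
  have hdA : 1 ≤ dA := by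
    by_contra h
    obtain rfl : dA = 0 := by omega
    simp [Matrix.trace] at hρtr
  rcases hdA.eq_or_lt with rfl | hdA
  · have h1 := natEntropy_le_ptraceA hρ
    have h2 := natEntropy_ptraceA_le hσ
    have h3 := mul_nonneg hh hlog2.le
    simp only [Nat.cast_one, Real.log_one, mul_zero, add_zero, Real.logb_one, zero_add] at h1 h2 ⊢
    linarith
  · have hy : 0 < ε / 2 := by positivity
    have hB : ptraceA σ + ptraceA P = ptraceA ρ + ptraceA N := by
      rw [← ptraceA_add, ← ptraceA_add, hsum]
    have h1 := natEntropy_sub_le hρ hσ hP hN hsum (by rw [hρtr, Complex.one_re]) hy (by linarith)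
      (by linarith)
    have h2 := natEntropy_sub_le (posSemidef_ptraceA hσ) (posSemidef_ptraceA hρ)
      (posSemidef_ptraceA hN) (posSemidef_ptraceA hP) hB
      (by rw [trace_ptraceA, hσtr, Complex.one_re]) hy (by linarith)
      (by rw [trace_ptraceA]; linarith)
    have h3 := natEntropy_le_ptraceA hP
    have h4 := natEntropy_ptraceA_le hN
    have h5 := entropy_mixing_bound hy (by linarith)
    rw [mul_div_cancel₀ ε two_ne_zero] at h5
    have hd : Real.log 2 ≤ Real.log dA := Real.log_le_log two_pos (by exact_mod_cast hdA)
    have hx : (P.trace.re + N.trace.re) * Real.log dA ≤ ε * Real.log dA :=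
      mul_le_mul_of_nonneg_right hdist (hlog2.le.trans hd)
    have hεd : ε * Real.log 2 ≤ ε * Real.log dA := mul_le_mul_of_nonneg_left hd hε0
    have hrhs : (4 * ε * Real.logb 2 dA + 2 * binEntropy ε) * Real.log 2 =
        4 * ε * Real.log dA + 2 * (-(ε * Real.log ε) - (1 - ε) * Real.log (1 - ε)) := by
      rw [binEntropy, Real.logb, Real.logb, Real.logb]
      field_simp
    have hlogε : Real.log (ε / 2) = Real.log ε - Real.log 2 := Real.log_div hε.ne' two_ne_zero
    rw [hrhs]
    rw [hlogε] at h1 h2 h5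
    linarith
end

section
/- (Continuity of the Holevo quantity, single-letter version of the bound established in the proof of Corollary 8/Corollary 'eetelctit'.) Let d ≥ 2, let X be a finite set, let p be a probability distribution on X, and let {σ_x : x ∈ X} and {σ'_x : x ∈ X} be families of density matrices on ℂ^d such that ‖σ_x − σ'_x‖₁ ≤ δ for all x ∈ X, where 0 ≤ δ < 1/e. Then |χ(p;{σ_x}) − χ(p;{σ'_x})| ≤ 8δ·log₂(d − 1) + 4h(δ). -/
open scoped BigOperators ComplexOrder

/-- The Holevo quantity of an ensemble of quantum states. -/
noncomputable def holevo {X : Type*} [Fintype X] {d : ℕ}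
    (p : X → ℝ) (σ : X → Matrix (Fin d) (Fin d) ℂ) : ℝ :=
  vnEntropy (∑ x, (p x : ℂ) • σ x) - ∑ x, p x * vnEntropy (σ x)

open Real in
/-- `negMulLog` is subadditive on the nonnegative reals. -/
theorem negMulLog_add_le_s2 {x y : ℝ} (hx : 0 ≤ x) (hy : 0 ≤ y) :
    negMulLog (x + y) ≤ negMulLog x + negMulLog y := by
  rcases hx.eq_or_lt with rfl | hx
  · simp
  rcases hy.eq_or_lt with rfl | hy
  · simp
  have h₁ := mul_le_mul_of_nonneg_left (log_le_log hx (by linarith : x ≤ x + y)) hx.le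
  have h₂ := mul_le_mul_of_nonneg_left (log_le_log hy (by linarith : y ≤ x + y)) hy.le
  simp only [negMulLog]
  linarith

open Real in
/-- `negMulLog` at `x` lies below its tangent line at `x + t`. -/
theorem negMulLog_le_tangent_s2 {x t : ℝ} (hx : 0 ≤ x) (ht : 0 ≤ t) :
    negMulLog x ≤ negMulLog (x + t) + t * (log (x + t) + 1) := by
  rcases hx.eq_or_lt with rfl | hx
  · simp only [negMulLog, zero_add, neg_zero, zero_mul]
    linarith
  have hxt : 0 < x + t := by linarith
  have h := mul_le_mul_of_nonneg_left (log_le_sub_one_of_pos (div_pos hxt hx)) hx.le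
  rw [log_div hxt.ne' hx.ne', mul_sub, mul_sub, mul_div_cancel₀ _ hx.ne'] at h
  simp only [negMulLog]
  linarith

open Real in
theorem log_le_neg_one_of_le {x : ℝ} (hx : 0 < x) (h : x ≤ 1 / exp 1) : log x ≤ -1 := by
  rwa [log_le_iff_le_exp hx, exp_neg, ← one_div]

open Real in
theorem self_le_negMulLog {x : ℝ} (hx : 0 ≤ x) (h : x ≤ 1 / exp 1) : x ≤ negMulLog x := by
  rcases hx.eq_or_lt with rfl | hx
  · simp
  have := mul_le_mul_of_nonneg_left (log_le_neg_one_of_le hx h) hx.le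
  simp only [negMulLog]
  linarith

open Real in
theorem negMulLog_monotoneOn : MonotoneOn negMulLog (Set.Icc 0 (1 / exp 1)) := by
  rintro x ⟨hx, -⟩ y ⟨hy, hye⟩ hxy
  rcases hy.eq_or_lt with rfl | hy
  · rw [le_antisymm hxy hx]
  have h := negMulLog_le_tangent_s2 hx (sub_nonneg.2 hxy)
  rw [add_sub_cancel] at h
  have := mul_nonneg (sub_nonneg.2 hxy) (by linarith [log_le_neg_one_of_le hy hye] : 0 ≤ -1 - log y)
  linarith

open Real in
/-- The modulus of continuity of `negMulLog` on `[0, 1]`, for small increments. -/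
theorem negMulLog_sub_le {x y : ℝ} (hx : 0 ≤ x) (hy : 0 ≤ y) (hy1 : y ≤ 1)
    (h : |x - y| ≤ 1 / exp 1) : negMulLog x - negMulLog y ≤ negMulLog |x - y| := by
  rcases le_total y x with hyx | hxy
  · rw [abs_of_nonneg (sub_nonneg.2 hyx)]
    have := negMulLog_add_le_s2 hy (sub_nonneg.2 hyx)
    rw [add_sub_cancel] at this
    linarith
  · rw [abs_sub_comm, abs_of_nonneg (sub_nonneg.2 hxy)] at h ⊢
    have h₁ := negMulLog_le_tangent_s2 hx (sub_nonneg.2 hxy)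
    rw [add_sub_cancel] at h₁
    have h₂ := mul_nonpos_of_nonneg_of_nonpos (sub_nonneg.2 hxy) (log_nonpos hy hy1)
    have h₃ := self_le_negMulLog (sub_nonneg.2 hxy) h
    linarith

open Real in
theorem sum_negMulLog_le_s2 {n : Type*} [Fintype n] [Nonempty n] {e : n → ℝ} (he : ∀ i, 0 ≤ e i) :
    ∑ i, negMulLog (e i) ≤ (∑ i, e i) * log (Fintype.card n) + negMulLog (∑ i, e i) := by
  have hc : (0 : ℝ) < Fintype.card n := by exact_mod_cast Fintype.card_pos
  have h := concaveOn_negMulLog.le_map_sum (t := Finset.univ)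
    (w := fun _ : n => (Fintype.card n : ℝ)⁻¹) (p := e) (fun _ _ => by positivity)
    (by simp [hc.ne']) (fun i _ => he i)
  simp only [smul_eq_mul, ← Finset.mul_sum] at h
  have h' := mul_le_mul_of_nonneg_left h hc.le
  rw [mul_inv_cancel_left₀ hc.ne', negMulLog_mul] at h'
  refine h'.trans_eq ?_
  simp only [negMulLog, log_inv]
  field_simp

open Real in
/-- A Fannes-type inequality for nonnegative vectors. -/
theorem sum_negMulLog_sub_le_s2 {n : Type*} [Fintype n] [Nonempty n] {a b : n → ℝ} {δ : ℝ}
    (ha : ∀ i, 0 ≤ a i) (hb : ∀ i, 0 ≤ b i) (hb1 : ∀ i, b i ≤ 1) (hδ : δ ≤ 1 / exp 1)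
    (h : ∑ i, |a i - b i| ≤ δ) :
    ∑ i, negMulLog (a i) - ∑ i, negMulLog (b i) ≤
      δ * log (Fintype.card n) + negMulLog δ := by
  have hs : 0 ≤ ∑ i, |a i - b i| := Finset.sum_nonneg fun _ _ => abs_nonneg _
  have hi : ∀ i, |a i - b i| ≤ 1 / exp 1 := fun i =>
    ((Finset.single_le_sum (fun j _ => abs_nonneg (a j - b j)) (Finset.mem_univ i)).trans h).trans hδ
  have hlog : 0 ≤ log (Fintype.card n : ℝ) := log_natCast_nonneg _
  calc ∑ i, negMulLog (a i) - ∑ i, negMulLog (b i)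
      = ∑ i, (negMulLog (a i) - negMulLog (b i)) := by rw [Finset.sum_sub_distrib]
    _ ≤ ∑ i, negMulLog |a i - b i| :=
        Finset.sum_le_sum fun i _ => negMulLog_sub_le (ha i) (hb i) (hb1 i) (hi i)
    _ ≤ (∑ i, |a i - b i|) * log (Fintype.card n) + negMulLog (∑ i, |a i - b i|) :=
        sum_negMulLog_le_s2 fun i => abs_nonneg _
    _ ≤ δ * log (Fintype.card n) + negMulLog δ :=
        add_le_add (mul_le_mul_of_nonneg_right h hlog)
          (negMulLog_monotoneOn ⟨hs, h.trans hδ⟩ ⟨hs.trans h, hδ⟩ h)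

/-- The real diagonal of `A` in the orthonormal basis given by the columns of `V`. -/
def diagIn {n : Type*} [Fintype n] (V A : Matrix n n ℂ) (i : n) : ℝ :=
  ((star V * A * V) i i).re

theorem diagIn_sub {n : Type*} [Fintype n] (V A B : Matrix n n ℂ) (i : n) :
    diagIn V (A - B) i = diagIn V A i - diagIn V B i := by
  simp [diagIn, mul_sub, sub_mul]

theorem diagIn_sum_smul {n X : Type*} [Fintype n] [Fintype X] (V : Matrix n n ℂ) (p : X → ℝ)
    (A : X → Matrix n n ℂ) (i : n) :
    diagIn V (∑ x, (p x : ℂ) • A x) i = ∑ x, p x * diagIn V (A x) i := by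
  simp [diagIn, Finset.mul_sum, Finset.sum_mul, Matrix.sum_apply]

theorem diagIn_nonneg {n : Type*} [Fintype n] {A : Matrix n n ℂ} (hA : A.PosSemidef)
    (V : Matrix n n ℂ) (i : n) : 0 ≤ diagIn V A i :=
  (Complex.le_def.1 (hA.conjTranspose_mul_mul_same V).diag_nonneg).1

theorem diagIn_eigenvectorUnitary {n : Type*} [Fintype n] [DecidableEq n] {A : Matrix n n ℂ}
    (hA : A.IsHermitian) (i : n) :
    diagIn (hA.eigenvectorUnitary : Matrix n n ℂ) A i = hA.eigenvalues i := by
  have h := hA.conjStarAlgAut_star_eigenvectorUnitary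
  rw [Unitary.conjStarAlgAut_star_apply] at h
  simp [diagIn, h]

/-- The diagonal of a Hermitian matrix in any orthonormal basis is the image of its spectrum
under a doubly stochastic matrix. -/
theorem exists_doublyStochastic_diagIn {n : Type*} [Fintype n] [DecidableEq n] {A : Matrix n n ℂ}
    (hA : A.IsHermitian) (V : Matrix.unitaryGroup n ℂ) :
    ∃ W : n → n → ℝ, (∀ i j, 0 ≤ W i j) ∧ (∀ i, ∑ j, W i j = 1) ∧ (∀ j, ∑ i, W i j = 1) ∧
      ∀ i, diagIn (V : Matrix n n ℂ) A i = ∑ j, W i j * hA.eigenvalues j := by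
  set Q : Matrix.unitaryGroup n ℂ := star V * hA.eigenvectorUnitary with hQ
  refine ⟨fun i j => Complex.normSq ((Q : Matrix n n ℂ) i j), fun i j => Complex.normSq_nonneg _,
    fun i => ?_, fun j => ?_, fun i => ?_⟩
  · have h := congrFun (congrFun (Matrix.mem_unitaryGroup_iff.1 Q.2) i) i
    simp only [Matrix.mul_apply, Matrix.star_apply, Matrix.one_apply_eq, RCLike.star_def,
      Complex.mul_conj] at h
    exact_mod_cast h
  · have h := congrFun (congrFun (Matrix.mem_unitaryGroup_iff'.1 Q.2) j) j
    simp only [Matrix.mul_apply, Matrix.star_apply, Matrix.one_apply_eq, RCLike.star_def,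
      mul_comm, Complex.mul_conj] at h
    exact_mod_cast h
  · have h : star (V : Matrix n n ℂ) * A * (V : Matrix n n ℂ) =
        (Q : Matrix n n ℂ) * Matrix.diagonal (RCLike.ofReal ∘ hA.eigenvalues) *
          star (Q : Matrix n n ℂ) := by
      conv_lhs => rw [hA.spectral_theorem, Unitary.conjStarAlgAut_apply]
      simp only [hQ, Submonoid.coe_mul, Unitary.coe_star, star_mul, star_star, Matrix.mul_assoc]
    rw [diagIn, h, Matrix.mul_apply, Complex.re_sum]
    refine Finset.sum_congr rfl fun j _ => ?_
    rw [Matrix.mul_diagonal, Matrix.star_apply, RCLike.star_def, mul_right_comm, Complex.mul_conj]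
    simp

theorem vnEntropy_mul_log_two {n : Type*} [Fintype n] [DecidableEq n] {A : Matrix n n ℂ}
    (hA : A.IsHermitian) :
    vnEntropy A * Real.log 2 = ∑ i, Real.negMulLog (hA.eigenvalues i) := by
  have h2 : Real.log 2 ≠ 0 := (Real.log_pos one_lt_two).ne'
  rw [vnEntropy, dif_pos hA, ← Finset.sum_neg_distrib, Finset.sum_mul]
  refine Finset.sum_congr rfl fun i _ => ?_
  rw [Real.logb, Real.negMulLog]
  field_simp

theorem binEntropy_mul_log_two (x : ℝ) :
    binEntropy x * Real.log 2 = Real.negMulLog x + Real.negMulLog (1 - x) := by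
  have h2 : Real.log 2 ≠ 0 := (Real.log_pos one_lt_two).ne'
  simp only [binEntropy, Real.logb, Real.negMulLog]
  field_simp
  ring

/-- Measuring in an orthonormal basis does not decrease the entropy. -/
theorem sum_negMulLog_eigenvalues_le {n : Type*} [Fintype n] [DecidableEq n] {A : Matrix n n ℂ}
    (hA : A.PosSemidef) (V : Matrix.unitaryGroup n ℂ) :
    ∑ i, Real.negMulLog (hA.isHermitian.eigenvalues i) ≤
      ∑ i, Real.negMulLog (diagIn (V : Matrix n n ℂ) A i) := by
  obtain ⟨W, hW, hrow, hcol, hd⟩ := exists_doublyStochastic_diagIn hA.isHermitian V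
  calc ∑ j, Real.negMulLog (hA.isHermitian.eigenvalues j)
      = ∑ i, ∑ j, W i j • Real.negMulLog (hA.isHermitian.eigenvalues j) := by
        rw [Finset.sum_comm]
        simp [← Finset.sum_mul, hcol]
    _ ≤ ∑ i, Real.negMulLog (diagIn (V : Matrix n n ℂ) A i) := by
        refine Finset.sum_le_sum fun i _ => ?_
        rw [hd i]
        exact Real.concaveOn_negMulLog.le_map_sum (fun j _ => hW i j) (hrow i)
          (fun j _ => hA.eigenvalues_nonneg j)

theorem sum_abs_diagIn_le_traceNorm {n : Type*} [Fintype n] [DecidableEq n] {A : Matrix n n ℂ}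
    (hA : A.IsHermitian) (V : Matrix.unitaryGroup n ℂ) :
    ∑ i, |diagIn (V : Matrix n n ℂ) A i| ≤ traceNorm A := by
  obtain ⟨W, hW, hrow, hcol, hd⟩ := exists_doublyStochastic_diagIn hA V
  rw [traceNorm, dif_pos hA]
  calc ∑ i, |diagIn (V : Matrix n n ℂ) A i|
      ≤ ∑ i, ∑ j, W i j * |hA.eigenvalues j| := by
        refine Finset.sum_le_sum fun i _ => ?_
        rw [hd i]
        refine (Finset.abs_sum_le_sum_abs _ _).trans_eq (Finset.sum_congr rfl fun j _ => ?_)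
        rw [abs_mul, abs_of_nonneg (hW i j)]
    _ = ∑ j, |hA.eigenvalues j| := by
        rw [Finset.sum_comm]
        simp [← Finset.sum_mul, hcol]

theorem eigenvalues_le_one_of_trace_eq_one {n : Type*} [Fintype n] [DecidableEq n]
    {A : Matrix n n ℂ} (hA : A.PosSemidef) (htr : A.trace = 1) (i : n) :
    hA.isHermitian.eigenvalues i ≤ 1 := by
  have h := hA.isHermitian.trace_eq_sum_eigenvalues
  rw [htr] at h
  have h' : (1 : ℝ) = ∑ j, hA.isHermitian.eigenvalues j := by
    simpa using congrArg Complex.re h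
  rw [h']
  exact Finset.single_le_sum (fun j _ => hA.eigenvalues_nonneg j) (Finset.mem_univ i)

/-- A Fannes-type inequality: the von Neumann entropy is continuous with respect to the distance
of the diagonals in all orthonormal bases. -/
theorem vnEntropy_sub_mul_log_two_le {n : Type*} [Fintype n] [DecidableEq n] [Nonempty n]
    {A B : Matrix n n ℂ} (hA : A.PosSemidef) (hB : B.PosSemidef) (hBtr : B.trace = 1)
    {δ : ℝ} (hδ : δ ≤ 1 / Real.exp 1)
    (h : ∀ V : Matrix.unitaryGroup n ℂ, ∑ i, |diagIn (V : Matrix n n ℂ) (A - B) i| ≤ δ) :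
    (vnEntropy A - vnEntropy B) * Real.log 2 ≤
      δ * Real.log (Fintype.card n) + Real.negMulLog δ := by
  have hV := h hB.isHermitian.eigenvectorUnitary
  simp only [diagIn_sub, diagIn_eigenvectorUnitary] at hV
  rw [sub_mul, vnEntropy_mul_log_two hA.isHermitian, vnEntropy_mul_log_two hB.isHermitian]
  exact (sub_le_sub_right (sum_negMulLog_eigenvalues_le hA _) _).trans
    (sum_negMulLog_sub_le_s2 (fun i => diagIn_nonneg hA _ i) (fun i => hB.eigenvalues_nonneg i)
      (eigenvalues_le_one_of_trace_eq_one hB hBtr) hδ hV)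

theorem fannes_bound_le {d : ℕ} (hd : 2 ≤ d) {δ : ℝ} (hδ0 : 0 ≤ δ) (hδ : δ ≤ 1 / Real.exp 1) :
    δ * Real.log d + Real.negMulLog δ ≤
      (4 * δ * Real.logb 2 ((d : ℝ) - 1) + 2 * binEntropy δ) * Real.log 2 := by
  have hd' : (2 : ℝ) ≤ d := by exact_mod_cast hd
  have h2 : 0 < Real.log 2 := Real.log_pos one_lt_two
  have hlog : Real.log d ≤ Real.log ((d : ℝ) - 1) + Real.log 2 := by
    rw [← Real.log_mul (by linarith) two_ne_zero]
    exact Real.log_le_log (by linarith) (by linarith)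
  have hlog0 : 0 ≤ Real.log ((d : ℝ) - 1) := Real.log_nonneg (by linarith)
  have h₁ := mul_le_mul_of_nonneg_left hlog hδ0
  have h₂ := mul_nonneg hδ0 hlog0
  have h₃ := self_le_negMulLog hδ0 hδ
  have hδ1 : δ ≤ 1 :=
    hδ.trans ((div_le_one (Real.exp_pos 1)).2 (Real.one_le_exp zero_le_one))
  have h₄ := Real.negMulLog_nonneg (sub_nonneg.2 hδ1) (by linarith)
  have h₅ := mul_le_mul_of_nonneg_left
    (by linarith [Real.log_two_lt_d9] : Real.log 2 ≤ 1) hδ0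
  have h₆ : Real.logb 2 ((d : ℝ) - 1) * Real.log 2 = Real.log ((d : ℝ) - 1) :=
    div_mul_cancel₀ _ h2.ne'
  rw [add_mul, mul_assoc (4 * δ), mul_assoc 2, h₆, binEntropy_mul_log_two]
  linarith

theorem abs_vnEntropy_sub_le {d : ℕ} (hd : 2 ≤ d) {A B : Matrix (Fin d) (Fin d) ℂ}
    (hA : A.PosSemidef) (hAtr : A.trace = 1) (hB : B.PosSemidef) (hBtr : B.trace = 1)
    {δ : ℝ} (hδ0 : 0 ≤ δ) (hδ : δ ≤ 1 / Real.exp 1)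
    (h : ∀ V : Matrix.unitaryGroup (Fin d) ℂ,
      ∑ i, |diagIn (V : Matrix (Fin d) (Fin d) ℂ) (A - B) i| ≤ δ) :
    |vnEntropy A - vnEntropy B| ≤
      4 * δ * Real.logb 2 ((d : ℝ) - 1) + 2 * binEntropy δ := by
  have : NeZero d := ⟨by omega⟩
  have hbound := fannes_bound_le hd hδ0 hδ
  have h2 : 0 < Real.log 2 := Real.log_pos one_lt_two
  have hAB := vnEntropy_sub_mul_log_two_le hA hB hBtr hδ h
  have hBA := vnEntropy_sub_mul_log_two_le hB hA hAtr hδ fun V => by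
    simpa only [diagIn_sub, abs_sub_comm] using h V
  rw [Fintype.card_fin] at hAB hBA
  rw [abs_sub_le_iff]
  exact ⟨le_of_mul_le_mul_right (hAB.trans hbound) h2,
    le_of_mul_le_mul_right (hBA.trans hbound) h2⟩

theorem posSemidef_sum_smul {n X : Type*} [Fintype X] {p : X → ℝ}
    (hp : ∀ x, 0 ≤ p x) {A : X → Matrix n n ℂ} (hA : ∀ x, (A x).PosSemidef) :
    (∑ x, (p x : ℂ) • A x).PosSemidef :=
  Matrix.posSemidef_sum _ fun x _ => (hA x).smul (Complex.zero_le_real.2 (hp x))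

theorem trace_sum_smul_eq_one {n X : Type*} [Fintype n] [Fintype X] {p : X → ℝ}
    (hp : ∑ x, p x = 1) {A : X → Matrix n n ℂ} (hA : ∀ x, (A x).trace = 1) :
    (∑ x, (p x : ℂ) • A x).trace = 1 := by
  simp only [Matrix.trace_sum, Matrix.trace_smul, hA, smul_eq_mul, mul_one]
  exact_mod_cast hp

theorem sum_mul_le_of_sum_eq_one {X : Type*} [Fintype X] {p f : X → ℝ} {c : ℝ}
    (hp0 : ∀ x, 0 ≤ p x) (hp1 : ∑ x, p x = 1) (hf : ∀ x, f x ≤ c) : ∑ x, p x * f x ≤ c :=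
  calc ∑ x, p x * f x ≤ ∑ x, p x * c :=
        Finset.sum_le_sum fun x _ => mul_le_mul_of_nonneg_left (hf x) (hp0 x)
    _ = c := by rw [← Finset.sum_mul, hp1, one_mul]

/-- **Continuity of the Holevo quantity** (single-letter bound). -/
theorem holevo_continuity (d : ℕ) (hd : 2 ≤ d) (X : Type*) [Fintype X]
    (p : X → ℝ) (hp0 : ∀ x, 0 ≤ p x) (hp1 : ∑ x, p x = 1)
    (σ σ' : X → Matrix (Fin d) (Fin d) ℂ)
    (hσ : ∀ x, (σ x).PosSemidef) (hσtr : ∀ x, (σ x).trace = 1)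
    (hσ' : ∀ x, (σ' x).PosSemidef) (hσ'tr : ∀ x, (σ' x).trace = 1)
    (δ : ℝ) (hδ0 : 0 ≤ δ) (hδ1 : δ < 1 / Real.exp 1)
    (hdist : ∀ x, traceNorm (σ x - σ' x) ≤ δ) :
    |holevo p σ - holevo p σ'|
      ≤ 8 * δ * Real.logb 2 ((d : ℝ) - 1) + 4 * binEntropy δ := by
  have hdiag : ∀ x, ∀ V : Matrix.unitaryGroup (Fin d) ℂ,
      ∑ i, |diagIn (V : Matrix (Fin d) (Fin d) ℂ) (σ x - σ' x) i| ≤ δ := fun x V =>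
    (sum_abs_diagIn_le_traceNorm ((hσ x).isHermitian.sub (hσ' x).isHermitian) V).trans (hdist x)
  have hmix := abs_vnEntropy_sub_le hd (posSemidef_sum_smul hp0 hσ)
    (trace_sum_smul_eq_one hp1 hσtr) (posSemidef_sum_smul hp0 hσ')
    (trace_sum_smul_eq_one hp1 hσ'tr) hδ0 hδ1.le fun V => by
      rw [← Finset.sum_sub_distrib]
      simp only [← smul_sub, diagIn_sum_smul]
      calc ∑ i, |∑ x, p x * diagIn (V : Matrix (Fin d) (Fin d) ℂ) (σ x - σ' x) i|
          ≤ ∑ i, ∑ x, p x * |diagIn (V : Matrix (Fin d) (Fin d) ℂ) (σ x - σ' x) i| := by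
            refine Finset.sum_le_sum fun i _ => (Finset.abs_sum_le_sum_abs _ _).trans_eq
              (Finset.sum_congr rfl fun x _ => ?_)
            rw [abs_mul, abs_of_nonneg (hp0 x)]
        _ = ∑ x, p x * ∑ i, |diagIn (V : Matrix (Fin d) (Fin d) ℂ) (σ x - σ' x) i| := by
            rw [Finset.sum_comm]
            simp only [Finset.mul_sum]
        _ ≤ δ := sum_mul_le_of_sum_eq_one hp0 hp1 fun x => hdiag x V
  have hcond : |∑ x, p x * vnEntropy (σ x) - ∑ x, p x * vnEntropy (σ' x)| ≤
      4 * δ * Real.logb 2 ((d : ℝ) - 1) + 2 * binEntropy δ := by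
    rw [← Finset.sum_sub_distrib]
    calc |∑ x, (p x * vnEntropy (σ x) - p x * vnEntropy (σ' x))|
        ≤ ∑ x, p x * |vnEntropy (σ x) - vnEntropy (σ' x)| := by
          refine (Finset.abs_sum_le_sum_abs _ _).trans_eq (Finset.sum_congr rfl fun x _ => ?_)
          rw [← mul_sub, abs_mul, abs_of_nonneg (hp0 x)]
      _ ≤ _ := sum_mul_le_of_sum_eq_one hp0 hp1 fun x =>
          abs_vnEntropy_sub_le hd (hσ x) (hσtr x) (hσ' x) (hσ'tr x) hδ0 hδ1.le (hdiag x)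
  rw [holevo, holevo, sub_sub_sub_comm]
  linarith [abs_sub (vnEntropy (∑ x, (p x : ℂ) • σ x) - vnEntropy (∑ x, (p x : ℂ) • σ' x))
    (∑ x, p x * vnEntropy (σ x) - ∑ x, p x * vnEntropy (σ' x))]
end

section
/- (Bound on the eavesdropper's Holevo quantity in Example 5/Example 'lt1122awtit', part ii.) For every integer n ≥ 1, every λ ∈ [0,1], and all a₀, a₁ ∈ (0,1) with a₀ + a₁ = 1, the following inequality holds: −(1/n) · ∑ (n! / (k₁! k₂! k₃!)) · (1−λ)^{k₁} · λ^{k₂} · a₀^{k₂} · λ^{k₃} · a₁^{k₃} · log₂(a₀^{k₂} · a₁^{k₃}) ≤ λ, where the sum ranges over all triples of nonnegative integers (k₁, k₂, k₃) with k₁ + k₂ + k₃ = n. -/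
open scoped BigOperators

/-- First moment of a linear functional against the multinomial weights. -/
theorem sum_multinomial_mul_prod_pow_mul_linear {ι : Type*} [DecidableEq ι] (s : Finset ι)
    (x c : ι → ℝ) (n : ℕ) :
    ∑ k ∈ s.piAntidiag n, (Nat.multinomial s k : ℝ) * (∏ i ∈ s, x i ^ k i)
        * (∑ i ∈ s, k i * c i)
      = n * (∑ i ∈ s, x i) ^ (n - 1) * ∑ i ∈ s, x i * c i := by
  have expand : (fun t : ℝ => (∑ i ∈ s, x i * Real.exp (t * c i)) ^ n)
      = fun t => ∑ k ∈ s.piAntidiag n, (Nat.multinomial s k : ℝ) * (∏ i ∈ s, x i ^ k i)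
        * Real.exp (t * ∑ i ∈ s, k i * c i) := by
    funext t
    rw [Finset.sum_pow_eq_sum_piAntidiag]
    refine Finset.sum_congr rfl fun k _ => ?_
    rw [mul_assoc, Finset.mul_sum, Real.exp_sum, ← Finset.prod_mul_distrib]
    congr 1
    refine Finset.prod_congr rfl fun i _ => ?_
    rw [mul_pow, ← Real.exp_nat_mul]
    ring_nf
  have deriv_exp (a : ℝ) : HasDerivAt (fun t : ℝ => Real.exp (t * a)) a 0 := by
    simpa using ((hasDerivAt_id (0 : ℝ)).mul_const a).exp
  have deriv_pow := (HasDerivAt.fun_sum (u := s)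
    fun i _ => (deriv_exp (c i)).const_mul (x i)).fun_pow n
  rw [expand] at deriv_pow
  have deriv_sum := HasDerivAt.fun_sum (u := s.piAntidiag n) fun k _ =>
    (deriv_exp (∑ i ∈ s, k i * c i)).const_mul
      ((Nat.multinomial s k : ℝ) * ∏ i ∈ s, x i ^ k i)
  simpa using deriv_sum.unique deriv_pow

/-- **Bound on the eavesdropper's Holevo quantity in Example 'lt1122awtit', part ii:**
the multinomial sum is bounded by λ. -/
theorem eavesdropper_holevo_bound (n : ℕ) (hn : 1 ≤ n)
    (lam : ℝ) (hlam : lam ∈ Set.Icc (0 : ℝ) 1)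
    (a₀ a₁ : ℝ) (ha₀ : a₀ ∈ Set.Ioo (0 : ℝ) 1) (ha₁ : a₁ ∈ Set.Ioo (0 : ℝ) 1)
    (hsum : a₀ + a₁ = 1) :
    -(1 / (n : ℝ)) * ∑ k ∈ Finset.Nat.antidiagonalTuple 3 n,
        (Nat.multinomial Finset.univ k : ℝ) * (1 - lam) ^ (k 0) * lam ^ (k 1)
          * a₀ ^ (k 1) * lam ^ (k 2) * a₁ ^ (k 2)
          * Real.logb 2 (a₀ ^ (k 1) * a₁ ^ (k 2))
      ≤ lam := by
  have moment := sum_multinomial_mul_prod_pow_mul_linear Finset.univ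
    ![1 - lam, lam * a₀, lam * a₁] ![0, Real.logb 2 a₀, Real.logb 2 a₁] n
  have total : 1 - lam + lam * a₀ + lam * a₁ = 1 := by linear_combination lam * hsum
  simp only [Fin.sum_univ_three, Fin.prod_univ_three, Matrix.cons_val, total, one_pow,
    mul_zero, zero_add, mul_one] at moment
  have sum_eq : ∑ k ∈ Finset.Nat.antidiagonalTuple 3 n,
        (Nat.multinomial Finset.univ k : ℝ) * (1 - lam) ^ (k 0) * lam ^ (k 1)
          * a₀ ^ (k 1) * lam ^ (k 2) * a₁ ^ (k 2)
          * Real.logb 2 (a₀ ^ (k 1) * a₁ ^ (k 2))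
      = n * (lam * a₀ * Real.logb 2 a₀ + lam * a₁ * Real.logb 2 a₁) := by
    rw [← moment, Finset.piAntidiag_univ_fin_eq_antidiagonalTuple]
    refine Finset.sum_congr rfl fun k _ => ?_
    rw [Real.logb_mul (pow_pos ha₀.1 _).ne' (pow_pos ha₁.1 _).ne', Real.logb_pow, Real.logb_pow]
    ring
  have entropy_le : -(a₀ * Real.logb 2 a₀ + a₁ * Real.logb 2 a₁) ≤ 1 := by
    have h := Real.binEntropy_le_log_two (p := a₀)
    rw [Real.binEntropy_eq_negMulLog_add_negMulLog_one_sub, ← eq_sub_of_add_eq' hsum] at h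
    have h_log : 0 < Real.log 2 := Real.log_pos one_lt_two
    calc -(a₀ * Real.logb 2 a₀ + a₁ * Real.logb 2 a₁)
        = (Real.negMulLog a₀ + Real.negMulLog a₁) / Real.log 2 := by
          simp only [Real.logb, Real.negMulLog]; ring
      _ ≤ 1 := (div_le_one h_log).2 h
  have hn_ne : (n : ℝ) ≠ 0 := by positivity
  calc _ = lam * -(a₀ * Real.logb 2 a₀ + a₁ * Real.logb 2 a₁) := by
        rw [sum_eq]; field_simp
    _ ≤ lam := mul_le_of_le_one_right hlam.1 entropy_le
end
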